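/- arXiv:1601.00990 — 4 statements merged into one kernel-verified Lean document; each statement's English description precedes it below -/
import Mathlib

section
/- Let A be a commutative ring, D : A → A a derivation, M an A-module, ∇ : M → M an additive map satisfying the Leibniz rule ∇(a • m) = D(a) • m + a • ∇m for all a ∈ A, m ∈ M, and ⟨·,·⟩ : M × M → A an A-bilinear pairing compatible with the derivation, i.e. D⟨u,v⟩ = ⟨∇u, v⟩ + ⟨u, ∇v⟩ for all u, v ∈ M. Let ω, R ∈ M and σ, F₂, F₁, F₀ ∈ A be such that σ • ∇³ω + F₂ • ∇²ω + F₁ • ∇ω + F₀ • ω = 0 (the Picard–Fuchs equation). Set ω̃ := ∇R, and assume ⟨ω̃, ω⟩ = 0 and ⟨ω̃, ∇ω⟩ = 0. Define the normal function value N := ⟨R, ω⟩ and the Yukawa coupling Y := ⟨ω̃, ∇²ω⟩. Then σ·D³N + F₂·D²N + F₁·DN + F₀·N = σ·Y. -/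
/-- The inhomogeneous Picard–Fuchs equation for a higher normal function.
`A` is a commutative ring, `D : A → A` a derivation, `M` an `A`-module,
`∇ : M → M` an additive map satisfying the Leibniz rule, and `B` an `A`-bilinear
pairing compatible with the derivation. If `σ • ∇³ω + F₂ • ∇²ω + F₁ • ∇ω + F₀ • ω = 0`,
`ωt := ∇R`, `⟨ωt, ω⟩ = 0` and `⟨ωt, ∇ω⟩ = 0`, then with `N := ⟨R, ω⟩` and
`Y := ⟨ωt, ∇²ω⟩` we have `σ·D³N + F₂·D²N + F₁·DN + F₀·N = σ·Y`. -/
theorem inhomogeneous_picard_fuchs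
    (A : Type*) [CommRing A] (M : Type*) [AddCommGroup M] [Module A M]
    (D : A → A)
    (hD_add : ∀ a b : A, D (a + b) = D a + D b)
    (hD_mul : ∀ a b : A, D (a * b) = D a * b + a * D b)
    (nabla : M → M)
    (hnabla_add : ∀ m m' : M, nabla (m + m') = nabla m + nabla m')
    (hLeibniz : ∀ (a : A) (m : M), nabla (a • m) = D a • m + a • nabla m)
    (B : M →ₗ[A] M →ₗ[A] A)
    (hcompat : ∀ u v : M, D (B u v) = B (nabla u) v + B u (nabla v))
    (ω R : M) (σ F₂ F₁ F₀ : A)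
    (hPF : σ • nabla (nabla (nabla ω)) + F₂ • nabla (nabla ω) + F₁ • nabla ω + F₀ • ω = 0)
    (ωt : M) (hωt : ωt = nabla R)
    (h0 : B ωt ω = 0) (h1 : B ωt (nabla ω) = 0)
    (N Y : A) (hN : N = B R ω) (hY : Y = B ωt (nabla (nabla ω))) :
    σ * D (D (D N)) + F₂ * D (D N) + F₁ * D N + F₀ * N = σ * Y := by
  subst hωt hN hY
  have hDN : D (B R ω) = B R (nabla ω) := by rw [hcompat, h0, zero_add]
  have hDDN : D (B R (nabla ω)) = B R (nabla (nabla ω)) := by rw [hcompat, h1, zero_add]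
  have hpair := congrArg (B R) hPF
  simp only [map_add, map_smul, smul_eq_mul, map_zero] at hpair
  rw [hDN, hDDN, hcompat R (nabla (nabla ω))]
  linear_combination hpair
end

section
/- Let P := (1+x+z)(1+x+y+z)(1+z)(y+z) ∈ ℤ[x,y,z], the numerator of the Minkowski polynomial φ = P/(xyz) giving the Landau–Ginzburg model of V₁₂, and for n ≥ 0 define a_n as the coefficient of the monomial xⁿyⁿzⁿ in Pⁿ (equivalently, the constant term of φⁿ). Then a₀ = 1, a₁ = 5, and for all n ≥ 2: n³·a_n = (34n³ − 51n² + 27n − 5)·a_{n−1} − (n−1)³·a_{n−2}. In other words, the period sequence of φ satisfies Apéry's recursion, i.e. the generating series Σ a_n tⁿ is annihilated by the Picard–Fuchs operator L = D³ − t(1+2D)(17D²+17D+5) + t²(D+1)³. -/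
open MvPolynomial

/-- The numerator `P = (1+x+z)(1+x+y+z)(1+z)(y+z)` of the Minkowski polynomial
`φ = P/(xyz)` giving the Landau–Ginzburg model of `V₁₂`, as a polynomial in the
variables `x = X 0`, `y = X 1`, `z = X 2`. -/
noncomputable def V12numerator : MvPolynomial (Fin 3) ℤ :=
  (1 + X 0 + X 2) * (1 + X 0 + X 1 + X 2) * (1 + X 2) * (X 1 + X 2)

/-- The period sequence of the Minkowski polynomial of `V₁₂`:
`a n` is the coefficient of `xⁿyⁿzⁿ` in `Pⁿ` (equivalently, the constant term
of `φⁿ`). -/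
noncomputable def V12period (n : ℕ) : ℤ :=
  MvPolynomial.coeff (Finsupp.equivFunOnFinite.symm fun _ : Fin 3 => n) (V12numerator ^ n)

/-- The summand `C(n,k) C(n+k,k)` whose squares add up to the Apéry numbers. -/
def aperyRoot (n k : ℕ) : ℚ := n.choose k * (n + k).choose k

theorem aperyRoot_eq_zero {n k : ℕ} (h : n < k) : aperyRoot n k = 0 := by
  simp [aperyRoot, Nat.choose_eq_zero_of_lt h]

theorem aperyRoot_add (j k : ℕ) :
    aperyRoot (j + k) k = ((j + k + k).factorial : ℚ) / (j.factorial * k.factorial ^ 2) := by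
  have h₁ := Nat.add_choose_mul_factorial_mul_factorial j k
  have h₂ := Nat.add_choose_mul_factorial_mul_factorial (j + k) k
  have hj : (j.factorial : ℚ) ≠ 0 := by positivity
  have hk : (k.factorial : ℚ) ≠ 0 := by positivity
  rw [← h₂, ← h₁, aperyRoot]
  push_cast
  field_simp

/-- The entries of the summand near `(m, k)` are polynomial multiples of a common rational. -/
theorem exists_aperyRoot_eq_mul (m k : ℕ) (h : k ≤ m + 2) :
    ∃ q : ℚ, aperyRoot (m + 2) k = (m + 2 + k) * (m + 1 + k) * q ∧
      aperyRoot (m + 1) k = (m + 1 + k) * (m + 2 - k) * q ∧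
      aperyRoot m k = (m + 2 - k) * (m + 1 - k) * q ∧
      ∀ l, k = l + 1 → aperyRoot (m + 1) l = k ^ 2 * q := by
  obtain ⟨j, hj⟩ := Nat.exists_eq_add_of_le' h
  refine ⟨((m + k).factorial : ℚ) / (j.factorial * k.factorial ^ 2), ?_, ?_, ?_, ?_⟩
  · rw [hj, aperyRoot_add, ← hj, show m + 2 + k = m + k + 1 + 1 by ring]
    simp only [Nat.factorial_succ]
    push_cast
    ring
  · obtain _ | j := j
    · have hm : (m : ℚ) + 2 = k := by exact_mod_cast (by omega : m + 2 = k)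
      rw [aperyRoot_eq_zero (by omega), hm]
      simp
    · have hm : (m : ℚ) + 2 = j + 1 + k := by exact_mod_cast hj
      rw [show m + 1 = j + k by omega, aperyRoot_add, show j + k + k = m + k + 1 by omega, hm]
      simp only [Nat.factorial_succ]
      push_cast
      field_simp
      ring
  · obtain _ | _ | j := j
    · have hm : (m : ℚ) + 2 = k := by exact_mod_cast (by omega : m + 2 = k)
      rw [aperyRoot_eq_zero (by omega), hm]
      simp
    · have hm : (m : ℚ) + 1 = k := by exact_mod_cast (by omega : m + 1 = k)
      rw [aperyRoot_eq_zero (by omega), hm]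
      simp
    · have hm : (m : ℚ) = j + k := by exact_mod_cast (by omega : m = j + k)
      obtain rfl : m = j + k := by omega
      rw [aperyRoot_add]
      simp only [Nat.factorial_succ]
      push_cast
      field_simp
      ring
  · rintro l rfl
    rw [show m + 1 = j + l by omega, aperyRoot_add, show j + l + l = m + (l + 1) by omega]
    simp only [Nat.factorial_succ]
    push_cast
    field_simp

/-- Zagier's telescoping certificate for Apéry's recursion, in summed form. -/
theorem sum_aperyRoot_certificate (m K : ℕ) (hK : K ≤ m + 2) :
    ∑ k ∈ Finset.range (K + 1), (((m : ℚ) + 2) ^ 3 * aperyRoot (m + 2) k ^ 2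
      - (34 * ((m : ℚ) + 2) ^ 3 - 51 * ((m : ℚ) + 2) ^ 2 + 27 * ((m : ℚ) + 2) - 5)
        * aperyRoot (m + 1) k ^ 2 + ((m : ℚ) + 1) ^ 3 * aperyRoot m k ^ 2)
      = 4 * (2 * m + 3) * (K * (2 * K + 1) - (2 * m + 3) ^ 2) * aperyRoot (m + 1) K ^ 2 := by
  induction K with
  | zero =>
    simp [aperyRoot]
    ring
  | succ K ih =>
    rw [Finset.sum_range_succ, ih (by omega)]
    obtain ⟨q, h₂, h₁, h₀, hq⟩ := exists_aperyRoot_eq_mul m (K + 1) hK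
    rw [h₂, h₁, h₀, hq K rfl]
    push_cast
    ring

/-- The Apéry numbers, as rationals. -/
def aperyNumber (n : ℕ) : ℚ := ∑ k ∈ Finset.range (n + 1), aperyRoot n k ^ 2

theorem aperyNumber_eq_sum_range {n N : ℕ} (h : n < N) :
    aperyNumber n = ∑ k ∈ Finset.range N, aperyRoot n k ^ 2 := by
  refine Finset.sum_subset (by simpa using h) fun k _ hk => ?_
  rw [aperyRoot_eq_zero (by simpa using hk), zero_pow two_ne_zero]

theorem aperyNumber_recursion (m : ℕ) :
    ((m : ℚ) + 2) ^ 3 * aperyNumber (m + 2)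
      = (34 * ((m : ℚ) + 2) ^ 3 - 51 * ((m : ℚ) + 2) ^ 2 + 27 * ((m : ℚ) + 2) - 5)
        * aperyNumber (m + 1) - ((m : ℚ) + 1) ^ 3 * aperyNumber m := by
  have h := sum_aperyRoot_certificate m (m + 2) le_rfl
  rw [aperyRoot_eq_zero (Nat.lt_succ_self (m + 1)), Finset.sum_add_distrib,
    Finset.sum_sub_distrib, ← Finset.mul_sum, ← Finset.mul_sum, ← Finset.mul_sum,
    ← aperyNumber_eq_sum_range (by omega), ← aperyNumber_eq_sum_range (by omega),
    ← aperyNumber_eq_sum_range (by omega)] at h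
  linear_combination h

theorem equivFunOnFinite_symm_const_succ (d n : ℕ) :
    (Finsupp.equivFunOnFinite.symm fun _ : Fin (d + 1) => n)
      = (Finsupp.equivFunOnFinite.symm fun _ : Fin d => n).cons n := by
  ext i
  refine Fin.cases ?_ (fun j => ?_) i <;> simp

/-- The constant exponent is invariant under permuting the variables. -/
theorem coeff_const_rename {d : ℕ} (e : Equiv.Perm (Fin d)) (n : ℕ) (p : MvPolynomial (Fin d) ℤ) :
    coeff (Finsupp.equivFunOnFinite.symm fun _ : Fin d => n) (rename e p)
      = coeff (Finsupp.equivFunOnFinite.symm fun _ : Fin d => n) p := by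
  rw [← coeff_rename_mapDomain e e.injective p]
  congr 1
  ext i
  rw [Finsupp.mapDomain_equiv_apply]
  rfl

theorem coeff_one_add_X_pow_mul_X_pow {n i : ℕ} (h : i ≤ n) :
    coeff (Finsupp.equivFunOnFinite.symm fun _ : Fin 1 => n)
      ((1 + X 0) ^ (2 * n - i) * X 0 ^ i : MvPolynomial (Fin 1) ℤ) = (2 * n - i).choose n := by
  rw [equivFunOnFinite_symm_const_succ, ← finSuccEquiv_coeff_coeff]
  simp only [map_mul, map_pow, map_add, map_one, finSuccEquiv_X_zero]
  rw [Polynomial.coeff_mul_X_pow', if_pos h, Polynomial.coeff_one_add_X_pow,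
    Nat.choose_symm_of_eq_add (show 2 * n - i = (n - i) + n by omega)]
  rw [← map_natCast (C (σ := Fin 0) (R := ℤ)), coeff_C, if_pos (Subsingleton.elim _ _)]

theorem coeff_trinomial_pow_mul {n i : ℕ} (h : i ≤ n) :
    coeff (Finsupp.equivFunOnFinite.symm fun _ : Fin 2 => n)
      ((X 0 + (1 + X 1)) ^ (2 * n - i) * ((1 + X 1) ^ n * X 1 ^ i) : MvPolynomial (Fin 2) ℤ)
      = ((2 * n - i).choose n : ℤ) ^ 2 := by
  rw [equivFunOnFinite_symm_const_succ, ← finSuccEquiv_coeff_coeff, ← Fin.succ_zero_eq_one]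
  simp only [map_mul, map_pow, map_add, map_one, finSuccEquiv_X_zero, finSuccEquiv_X_succ]
  have e : ((Polynomial.X + (1 + Polynomial.C (X 0))) ^ (2 * n - i) *
      ((1 + Polynomial.C (X 0)) ^ n * Polynomial.C (X 0) ^ i) :
        Polynomial (MvPolynomial (Fin 1) ℤ)) =
      (Polynomial.X + Polynomial.C (1 + X 0)) ^ (2 * n - i) *
        Polynomial.C ((1 + X 0) ^ n * X 0 ^ i) := by simp
  rw [e, Polynomial.coeff_mul_C, Polynomial.coeff_X_add_C_pow,
    show ((1 + X 0) ^ (2 * n - i - n) * ((2 * n - i).choose n : MvPolynomial (Fin 1) ℤ) *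
      ((1 + X 0) ^ n * X 0 ^ i)) = C ((2 * n - i).choose n : ℤ) *
        ((1 + X 0) ^ (2 * n - i - n + n) * X 0 ^ i) by rw [map_natCast]; ring,
    Nat.sub_add_cancel (by omega), coeff_C_mul, coeff_one_add_X_pow_mul_X_pow h, sq]

theorem V12period_eq_sum (n : ℕ) :
    V12period n
      = ∑ i ∈ Finset.range (n + 1), ((n.choose i : ℤ) * (2 * n - i).choose n) ^ 2 := by
  have e : finSuccEquiv ℤ 2 (rename (Equiv.swap (0 : Fin 3) 1) (V12numerator ^ n)) =
      (Polynomial.X + Polynomial.C (X 0 + (1 + X 1))) ^ n * (Polynomial.X + Polynomial.C (X 1)) ^ n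
        * Polynomial.C ((X 0 + (1 + X 1)) ^ n * (1 + X 1) ^ n) := by
    have h₂ : Equiv.swap (0 : Fin 3) 1 2 = 2 := by decide
    have h₁ : finSuccEquiv ℤ 2 (X 1) = Polynomial.C (X 0) := finSuccEquiv_X_succ (j := 0)
    have h₃ : finSuccEquiv ℤ 2 (X 2) = Polynomial.C (X 1) := finSuccEquiv_X_succ (j := 1)
    simp only [V12numerator, map_mul, map_pow, map_add, map_one, rename_X, Equiv.swap_apply_left,
      Equiv.swap_apply_right, h₂, h₁, h₃, finSuccEquiv_X_zero, ← mul_pow]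
    ring
  rw [V12period, ← coeff_const_rename (Equiv.swap 0 1), equivFunOnFinite_symm_const_succ,
    ← finSuccEquiv_coeff_coeff, e, Polynomial.coeff_mul_C, Polynomial.coeff_mul,
    Finset.Nat.sum_antidiagonal_eq_sum_range_succ_mk, Finset.sum_mul, coeff_sum]
  refine Finset.sum_congr rfl fun i hi => ?_
  have hi : i ≤ n := by simpa [Nat.lt_succ_iff] using hi
  rw [Polynomial.coeff_X_add_C_pow, Polynomial.coeff_X_add_C_pow, Nat.choose_symm hi,
    Nat.sub_sub_self hi, mul_pow, ← coeff_trinomial_pow_mul hi,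
    show 2 * n - i = (n - i) + n by omega, ← coeff_C_mul]
  congr 1
  rw [map_pow, map_natCast]
  ring

theorem V12period_cast (n : ℕ) : (V12period n : ℚ) = aperyNumber n := by
  rw [V12period_eq_sum, aperyNumber, ← Finset.sum_range_reflect]
  push_cast
  refine Finset.sum_congr rfl fun k hk => ?_
  have hk : k ≤ n := by simpa [Nat.lt_succ_iff] using hk
  rw [aperyRoot, Nat.choose_symm hk, show 2 * n - (n - k) = n + k by omega,
    Nat.choose_symm_add]

/-- The period sequence of the Landau–Ginzburg model of `V₁₂`
satisfies `a₀ = 1`, `a₁ = 5`, and Apéry's recursion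
`n³·aₙ = (34n³ − 51n² + 27n − 5)·a_{n−1} − (n−1)³·a_{n−2}` for `n ≥ 2`;
i.e. its generating series is annihilated by the Picard–Fuchs operator
`L = D³ − t(1+2D)(17D²+17D+5) + t²(D+1)³`. -/
theorem V12_period_satisfies_apery_recursion :
    V12period 0 = 1 ∧ V12period 1 = 5 ∧
    ∀ n : ℕ, 2 ≤ n →
      (n : ℤ) ^ 3 * V12period n
        = (34 * (n : ℤ) ^ 3 - 51 * (n : ℤ) ^ 2 + 27 * (n : ℤ) - 5) * V12period (n - 1)
          - ((n : ℤ) - 1) ^ 3 * V12period (n - 2) := by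
  refine ⟨?_, ?_, fun n hn => ?_⟩
  · simp [V12period_eq_sum]
  · simp [V12period_eq_sum, Finset.sum_range_succ]
  · obtain ⟨m, rfl⟩ := Nat.exists_eq_add_of_le' hn
    have h := aperyNumber_recursion m
    rw [show m + 2 - 1 = m + 1 by omega, Nat.add_sub_cancel]
    simp only [← V12period_cast] at h
    qify
    rw [h]
    ring
end

section
/- Define the Apéry sequence (a_n) of rational numbers by a₀ = 1, a₁ = 5, and n³·a_n = (34n³ − 51n² + 27n − 5)·a_{n−1} − (n−1)³·a_{n−2} for n ≥ 2. Then a_n > 0 for all n, and limsup_{n→∞} a_n^{1/n} = 17 + 12√2; equivalently, the radius of convergence of the period series A(t) = Σ a_n tⁿ equals 17 − 12√2. -/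
open Filter

/-- The recurrence relation of the Apéry numbers, shifted to be subtraction-free in the index. -/
def IsAperyRec (b : ℕ → ℝ) : Prop :=
  ∀ n : ℕ, ((n : ℝ) + 2) ^ 3 * b (n + 2)
    = (2 * (n : ℝ) + 3) * (17 * ((n : ℝ) + 1) ^ 2 + 17 * ((n : ℝ) + 1) + 5) * b (n + 1)
      - ((n : ℝ) + 1) ^ 3 * b n

theorem IsAperyRec.pos_and_le_succ {b : ℕ → ℝ} (hb : IsAperyRec b) (h0 : 0 < b 0)
    (h1 : b 0 ≤ b 1) (n : ℕ) : 0 < b n ∧ b n ≤ b (n + 1) := by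
  induction n with
  | zero => exact ⟨h0, h1⟩
  | succ n ih =>
    obtain ⟨hpos, hle⟩ := ih
    have hpos' : 0 < b (n + 1) := hpos.trans_le hle
    refine ⟨hpos', ?_⟩
    have hn : (0 : ℝ) ≤ n := n.cast_nonneg
    have key : ((n : ℝ) + 2) ^ 3 * b (n + 1) ≤ ((n : ℝ) + 2) ^ 3 * b (n + 2) := by
      rw [hb n]
      have e1 : ((n : ℝ) + 1) ^ 3 * b n ≤ ((n : ℝ) + 1) ^ 3 * b (n + 1) := by gcongr
      have e2 : 0 ≤ ((2 * (n : ℝ) + 3) * (17 * ((n : ℝ) + 1) ^ 2 + 17 * ((n : ℝ) + 1) + 5)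
          - ((n : ℝ) + 1) ^ 3 - ((n : ℝ) + 2) ^ 3) * b (n + 1) := by
        refine mul_nonneg ?_ hpos'.le
        ring_nf
        positivity
      linarith
    exact le_of_mul_le_mul_left key (by positivity)

theorem abs_ratio_sub_le {x l r r' : ℝ} (hx : 2 ≤ x) (hl : 33 ≤ l) (hl' : l = 34 - l⁻¹)
    (hr : 1 ≤ r) (hrec : x ^ 3 * r' = (34 * x ^ 3 - 51 * x ^ 2 + 27 * x - 5) - (x - 1) ^ 3 * r⁻¹)
    (h : |r - l| ≤ 60 / (x - 1)) : |r' - l| ≤ 60 / x := by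
  have hx0 : 0 < x := by linarith
  have hr0 : 0 < r := by linarith
  have hl0 : 0 < l := by linarith
  have e : r' - l = (-51 * x ^ 2 + 27 * x - 5) / x ^ 3
      + (3 * x ^ 2 - 3 * x + 1) / x ^ 3 * r⁻¹ + (r - l) * (l⁻¹ * r⁻¹) := by
    have hr' : r' = ((34 * x ^ 3 - 51 * x ^ 2 + 27 * x - 5) - (x - 1) ^ 3 * r⁻¹) / x ^ 3 := by
      rw [← hrec]; field_simp
    have : (r - l) * (l⁻¹ * r⁻¹) = l⁻¹ - r⁻¹ := by field_simp
    rw [this, hr']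
    nth_rewrite 1 [hl']
    field_simp
    ring
  have hrinv : r⁻¹ ≤ 1 := inv_le_one_of_one_le₀ hr
  have hrinv0 : 0 < r⁻¹ := by positivity
  have hlinv : l⁻¹ ≤ 33⁻¹ := inv_anti₀ (by norm_num) hl
  have hlinv0 : 0 < l⁻¹ := by positivity
  have b1 : |(-51 * x ^ 2 + 27 * x - 5) / x ^ 3| ≤ 51 / x := by
    rw [abs_div, abs_of_pos (pow_pos hx0 3), div_le_div_iff₀ (by positivity) hx0]
    have : |-51 * x ^ 2 + 27 * x - 5| ≤ 51 * x ^ 2 := by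
      rw [abs_le]; constructor <;> nlinarith
    calc _ ≤ 51 * x ^ 2 * x := by gcongr
      _ = _ := by ring
  have b2 : |(3 * x ^ 2 - 3 * x + 1) / x ^ 3 * r⁻¹| ≤ 3 / x := by
    rw [abs_mul, abs_of_pos hrinv0, abs_div, abs_of_pos (pow_pos hx0 3)]
    have : |3 * x ^ 2 - 3 * x + 1| ≤ 3 * x ^ 2 := by
      rw [abs_le]; constructor <;> nlinarith
    calc _ ≤ 3 * x ^ 2 / x ^ 3 * 1 := by gcongr
      _ = 3 / x := by field_simp
  have b3 : |(r - l) * (l⁻¹ * r⁻¹)| ≤ 4 / x := by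
    rw [abs_mul, abs_of_pos (mul_pos hlinv0 hrinv0)]
    have hx1 : 0 < x - 1 := by linarith
    calc _ ≤ 60 / (x - 1) * (33⁻¹ * 1) := by gcongr
      _ ≤ 4 / x := by
        rw [div_mul_eq_mul_div, div_le_div_iff₀ hx1 hx0]
        linarith
  rw [e]
  calc _ ≤ 51 / x + 3 / x + 4 / x := (abs_add_three _ _ _).trans (by gcongr)
    _ ≤ 60 / x := by
      rw [← add_div, ← add_div]
      gcongr
      norm_num

theorem IsAperyRec.tendsto_ratio {b : ℕ → ℝ} (hb : IsAperyRec b) (h0 : b 0 = 1) (h1 : b 1 = 5) :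
    Tendsto (fun n => b (n + 1) / b n) atTop (nhds (17 + 12 * Real.sqrt 2)) := by
  have hs : Real.sqrt 2 ^ 2 = 2 := Real.sq_sqrt (by norm_num)
  have hs1 : 4 / 3 ≤ Real.sqrt 2 := Real.le_sqrt_of_sq_le (by norm_num)
  have hs2 : Real.sqrt 2 ≤ 3 / 2 := Real.sqrt_le_iff.2 (by norm_num)
  set l : ℝ := 17 + 12 * Real.sqrt 2 with hl
  have hl33 : 33 ≤ l := by linarith
  have hl' : l = 34 - l⁻¹ := by
    have : l⁻¹ = 17 - 12 * Real.sqrt 2 := inv_eq_of_mul_eq_one_right (by rw [hl]; nlinarith)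
    rw [this, hl]; ring
  have hmono := hb.pos_and_le_succ (by rw [h0]; norm_num) (by rw [h0, h1]; norm_num)
  have hbound : ∀ n : ℕ, |b (n + 1) / b n - l| ≤ 60 / ((n : ℝ) + 1) := by
    intro n
    induction n with
    | zero =>
      rw [zero_add, h0, h1, abs_le]
      constructor <;> norm_num <;> linarith
    | succ n ih =>
      have hn : (0 : ℝ) ≤ n := n.cast_nonneg
      have p0 := (hmono n).1
      have p1 := (hmono (n + 1)).1
      have := abs_ratio_sub_le (x := (n : ℝ) + 2) (r := b (n + 1) / b n)
        (r' := b (n + 2) / b (n + 1)) (by linarith) hl33 hl'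
        ((one_le_div p0).2 (hmono n).2) ?_ (by convert ih using 2; ring)
      · convert this using 2
        push_cast; ring
      · have := hb n
        rw [inv_div, mul_div_assoc', this]
        field_simp
        ring
  rw [tendsto_iff_norm_sub_tendsto_zero]
  refine squeeze_zero (fun _ => norm_nonneg _) hbound ?_
  have := (tendsto_one_div_add_atTop_nhds_zero_nat (𝕜 := ℝ)).const_mul 60
  simpa [div_eq_mul_inv] using this

/-- If the ratios of consecutive terms of a positive sequence converge to a positive limit, then
so do the `n`-th roots. -/
theorem tendsto_rpow_inv_of_tendsto_ratio {b : ℕ → ℝ} {l : ℝ} (hb : ∀ n, 0 < b n) (hl : 0 < l)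
    (h : Tendsto (fun n => b (n + 1) / b n) atTop (nhds l)) :
    Tendsto (fun n : ℕ => b n ^ ((n : ℝ)⁻¹)) atTop (nhds l) := by
  have hsum : ∀ n : ℕ, ∑ i ∈ Finset.range n, Real.log (b (i + 1) / b i)
      = Real.log (b n) - Real.log (b 0) := by
    intro n
    rw [← Finset.sum_range_sub (fun i => Real.log (b i))]
    exact Finset.sum_congr rfl fun i _ => Real.log_div (hb _).ne' (hb _).ne'
  have hces := (h.log hl.ne').cesaro
  have hinv : Tendsto (fun n : ℕ => (n : ℝ)⁻¹ * Real.log (b 0)) atTop (nhds 0) := by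
    simpa using (tendsto_inv_atTop_nhds_zero_nat (𝕜 := ℝ)).mul_const (Real.log (b 0))
  have hexp := (hces.add hinv).rexp
  rw [add_zero, Real.exp_log hl] at hexp
  refine hexp.congr fun n => ?_
  rw [hsum, Real.rpow_def_of_pos (hb n)]
  congr 1
  ring

/-- The Apéry sequence `a₀ = 1`, `a₁ = 5`,
`n³·aₙ = (34n³ − 51n² + 27n − 5)·a_{n−1} − (n−1)³·a_{n−2}` (the period sequence
of the Landau–Ginzburg model of `V₁₂`) is positive and satisfies
`limsup aₙ^{1/n} = 17 + 12√2`; equivalently, the radius of convergence of the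
period series `A(t) = Σ aₙ tⁿ` is `17 − 12√2`. -/
theorem apery_sequence_growth (a : ℕ → ℚ)
    (h0 : a 0 = 1) (h1 : a 1 = 5)
    (hrec : ∀ n : ℕ, 2 ≤ n →
      (n : ℚ) ^ 3 * a n
        = (34 * (n : ℚ) ^ 3 - 51 * (n : ℚ) ^ 2 + 27 * (n : ℚ) - 5) * a (n - 1)
          - ((n : ℚ) - 1) ^ 3 * a (n - 2)) :
    (∀ n : ℕ, 0 < a n) ∧
      Filter.limsup (fun n : ℕ => ((a n : ℝ)) ^ ((n : ℝ)⁻¹)) atTop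
        = 17 + 12 * Real.sqrt 2 := by
  have hb : IsAperyRec (fun n => (a n : ℝ)) := by
    intro n
    have h := hrec (n + 2) (by omega)
    rw [show n + 2 - 1 = n + 1 by omega, show n + 2 - 2 = n by omega] at h
    have h' := congrArg (fun q : ℚ => (q : ℝ)) h
    push_cast at h'
    linear_combination h'
  have hpos : ∀ n, (0 : ℝ) < a n := fun n =>
    (hb.pos_and_le_succ (by simp [h0]) (by simp [h0, h1]) n).1
  refine ⟨fun n => by exact_mod_cast hpos n, ?_⟩
  exact (tendsto_rpow_inv_of_tendsto_ratio hpos (by positivity)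
    (hb.tendsto_ratio (by simp [h0]) (by simp [h1]))).limsup_eq
end

section
/- Define sequences of rational numbers (a_n) and (b_n) by: a₀ = 1, a₁ = 5; b₀ = 0, b₁ = 1; and for all n ≥ 2 both satisfy the recursion n³·u_n = (34n³ − 51n² + 27n − 5)·u_{n−1} − (n−1)³·u_{n−2}. Then a_n ≠ 0 for all n, the limit lim_{n→∞} b_n/a_n exists, and there is a nonzero rational number c such that lim_{n→∞} b_n/a_n = c·ζ(3), where ζ(3) = Σ_{k≥1} 1/k³. -/
open Filter

/-- The product of binomial coefficients `C(n, k) C(n + k, k)`. -/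
def aperyBinom (n k : ℕ) : ℚ := (n.choose k : ℚ) * ((n + k).choose k : ℚ)

/-- The partial sums `∑_{m ≤ n} 1 / m ^ 3`. -/
def cubeHarmonic (n : ℕ) : ℚ := ∑ m ∈ Finset.range n, 1 / ((m : ℚ) + 1) ^ 3

/-- The correction term `∑_{m ≤ k} (-1) ^ (m - 1) / (2 m ^ 3 C(n, m) C(n + m, m))`. -/
def aperyCorrection (n k : ℕ) : ℚ :=
  ∑ m ∈ Finset.range k, (-1) ^ m / (2 * ((m : ℚ) + 1) ^ 3 * aperyBinom n (m + 1))

/-- Apéry's double sequence `c(n, k)`, which converges to `ζ(3)` uniformly in `k ≤ n`. -/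
def aperyApprox (n k : ℕ) : ℚ := cubeHarmonic n + aperyCorrection n k

/-- Apéry's denominators. -/
def aperyDen (n : ℕ) : ℚ := ∑ k ∈ Finset.range (n + 1), aperyBinom n k ^ 2

/-- Apéry's numerators. -/
def aperyNum (n : ℕ) : ℚ :=
  ∑ k ∈ Finset.range (n + 1), aperyBinom n k ^ 2 * aperyApprox n k

theorem aperyBinom_succ_left (n k : ℕ) :
    aperyBinom (n + 1) k * ((n : ℚ) + 1 - k) = (n + 1 + k) * aperyBinom n k := by
  have h1 : ((n.choose k : ℕ) : ℚ) * (n + 1) = ((n + 1).choose k : ℚ) * ((n : ℚ) + 1 - k) := by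
    rcases le_or_gt k (n + 1) with h | h
    · have := Nat.choose_mul_succ_eq n k
      have h' : ((n + 1 - k : ℕ) : ℚ) = (n : ℚ) + 1 - k := by push_cast [Nat.cast_sub h]; ring
      rw [← h']
      exact_mod_cast this
    · rw [Nat.choose_eq_zero_of_lt h, Nat.choose_eq_zero_of_lt (by omega)]
      simp
  have h2 : (((n + k).choose k : ℕ) : ℚ) * (n + k + 1)
      = ((n + k + 1).choose k : ℚ) * ((n : ℚ) + 1) := by
    have := Nat.choose_mul_succ_eq (n + k) k
    rw [show n + k + 1 - k = n + 1 by omega] at this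
    exact_mod_cast this
  have h3 : (n : ℚ) + 1 ≠ 0 := by positivity
  unfold aperyBinom
  rw [show n + 1 + k = n + k + 1 by ring]
  apply mul_right_cancel₀ h3
  linear_combination (-((n + k + 1).choose k : ℚ) * (n + 1)) * h1 -
    (n.choose k : ℚ) * (n + 1) * h2

theorem aperyBinom_succ_right (n k : ℕ) :
    aperyBinom n (k + 1) * ((k : ℚ) + 1) ^ 2 = (n + k + 1) * (n - k) * aperyBinom n k := by
  have h1 : (n.choose (k + 1) : ℚ) * (k + 1) = (n.choose k : ℚ) * ((n : ℚ) - k) := by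
    rcases le_or_gt k n with h | h
    · have := Nat.choose_succ_right_eq n k
      rw [← Nat.cast_sub h]
      exact_mod_cast this
    · rw [Nat.choose_eq_zero_of_lt h, Nat.choose_eq_zero_of_lt (by omega)]
      simp
  have h2 : ((n : ℚ) + k + 1) * ((n + k).choose k : ℚ)
      = ((n + k + 1).choose (k + 1) : ℚ) * (k + 1) := by
    exact_mod_cast Nat.add_one_mul_choose_eq (n + k) k
  unfold aperyBinom
  rw [show n + (k + 1) = n + k + 1 by ring]
  linear_combination (((n + k + 1).choose (k + 1) : ℚ) * (k + 1)) * h1 -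
    (n.choose k : ℚ) * (n - k) * h2

theorem aperyBinom_neighbours (k j : ℕ) :
    aperyBinom (k + j) (k + 1)
        = aperyBinom (k + j + 1) (k + 1) * j / (k + j + 1 + k + 1) ∧
      aperyBinom (k + j + 2) (k + 1)
        = aperyBinom (k + j + 1) (k + 1) * (k + j + 1 + 1 + (k + 1)) / (j + 1) ∧
      aperyBinom (k + j + 1) k
        = aperyBinom (k + j + 1) (k + 1) * (k + 1) ^ 2 / ((k + j + 1 + k + 1) * (j + 1)) := by
  have e1 := aperyBinom_succ_left (k + j) (k + 1)
  have e2 := aperyBinom_succ_left (k + j + 1) (k + 1)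
  have e3 := aperyBinom_succ_right (k + j + 1) k
  have p1 : (j : ℚ) + 1 ≠ 0 := by positivity
  have p2 : (k : ℚ) + j + 1 + k + 1 ≠ 0 := by positivity
  push_cast at e1 e2 e3
  refine ⟨?_, ?_, ?_⟩
  · rw [eq_div_iff p2]; linear_combination -e1
  · rw [eq_div_iff p1]; linear_combination e2
  · rw [eq_div_iff (mul_ne_zero p2 p1)]; linear_combination -e3

theorem aperyBinom_pos {n k : ℕ} (h : k ≤ n) : 0 < aperyBinom n k := by
  have h1 := Nat.choose_pos h
  have h2 := Nat.choose_pos (Nat.le_add_left k n)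
  unfold aperyBinom
  positivity

theorem aperyBinom_eq_zero {n k : ℕ} (h : n < k) : aperyBinom n k = 0 := by
  simp [aperyBinom, Nat.choose_eq_zero_of_lt h]

@[simp] theorem aperyBinom_zero (n : ℕ) : aperyBinom n 0 = 1 := by
  simp [aperyBinom]

theorem le_aperyBinom {n k : ℕ} (hk : 1 ≤ k) (h : k ≤ n) : (n : ℚ) + 1 ≤ aperyBinom n k := by
  have h1 : 1 ≤ n.choose k := Nat.choose_pos h
  have h2 : n + 1 ≤ (n + k).choose k := by
    rw [Nat.choose_symm_add.symm]
    calc n + 1 = (n + 1).choose n := by simp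
      _ ≤ (n + k).choose n := Nat.choose_le_choose n (by omega)
  unfold aperyBinom
  exact_mod_cast (Nat.mul_le_mul h1 h2).trans' (by simp)

theorem cubeHarmonic_succ (n : ℕ) :
    cubeHarmonic (n + 1) = cubeHarmonic n + 1 / ((n : ℚ) + 1) ^ 3 :=
  Finset.sum_range_succ _ _

theorem aperyApprox_zero (n : ℕ) : aperyApprox n 0 = cubeHarmonic n := by
  simp [aperyApprox, aperyCorrection]

theorem aperyApprox_succ_right (n k : ℕ) :
    aperyApprox n (k + 1) = aperyApprox n k +
      (-1) ^ k / (2 * ((k : ℚ) + 1) ^ 3 * aperyBinom n (k + 1)) := by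
  rw [aperyApprox, aperyApprox, aperyCorrection, Finset.sum_range_succ, ← aperyCorrection, add_assoc]

theorem aperyApprox_succ_left {n k : ℕ} (h : k ≤ n) :
    aperyApprox (n + 1) k = aperyApprox n k +
      (-1) ^ k / (((n : ℚ) + 1) ^ 2 * aperyBinom n k * (n + 1 + k)) := by
  induction k with
  | zero =>
    rw [aperyApprox_zero, aperyApprox_zero, cubeHarmonic_succ]
    simp [pow_succ]
  | succ k ih =>
    rw [aperyApprox_succ_right, aperyApprox_succ_right, ih (by omega)]
    obtain ⟨j, rfl⟩ := Nat.exists_eq_add_of_le h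
    have hD := (aperyBinom_pos h).ne'
    have e1 := aperyBinom_succ_left (k + 1 + j) (k + 1)
    have e2 := aperyBinom_succ_right (k + 1 + j) k
    push_cast at e1 e2 ⊢
    have p1 : (j : ℚ) + 1 ≠ 0 := by positivity
    have p2 : (k : ℚ) + 1 + j + k + 1 ≠ 0 := by positivity
    have p3 : (k : ℚ) + 1 + j + 1 + (k + 1) ≠ 0 := by positivity
    have p4 : (k : ℚ) + 1 ≠ 0 := by positivity
    have p5 : (k : ℚ) + 1 + j + 1 ≠ 0 := by positivity
    have f1 : aperyBinom (k + 1 + j + 1) (k + 1)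
        = (k + 1 + j + 1 + (k + 1)) * aperyBinom (k + 1 + j) (k + 1) / (j + 1) := by
      rw [eq_div_iff p1]; linear_combination e1
    have f2 : aperyBinom (k + 1 + j) k
        = aperyBinom (k + 1 + j) (k + 1) * (k + 1) ^ 2 / ((k + 1 + j + k + 1) * (j + 1)) := by
      rw [eq_div_iff (mul_ne_zero p2 p1)]; linear_combination -e2
    rw [f1, f2, pow_succ (-1 : ℚ) k]
    generalize aperyBinom (k + 1 + j) (k + 1) = D at *
    field_simp
    ring

/-- The Wilf–Zeilberger certificate for `aperyDen`. -/
def aperyDenCert (n k : ℕ) : ℚ :=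
  4 * (2 * n + 1) * (k * (2 * k + 1) - (2 * n + 1) ^ 2) * aperyBinom n k ^ 2

/-- The Wilf–Zeilberger certificate for `aperyNum`. -/
def aperyNumCert (n k : ℕ) : ℚ :=
  aperyDenCert n k * aperyApprox n k -
    5 * (2 * n + 1) * (-1) ^ k * k / (n * (n + 1)) * aperyBinom n k

/-- Apéry's recurrence operator, shifted so that the lowest index is `n`. -/
def aperyOp (u : ℕ → ℚ) (n : ℕ) : ℚ :=
  ((n : ℚ) + 2) ^ 3 * u (n + 2)
    - (34 * ((n : ℚ) + 2) ^ 3 - 51 * ((n : ℚ) + 2) ^ 2 + 27 * ((n : ℚ) + 2) - 5) * u (n + 1)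
    + ((n : ℚ) + 1) ^ 3 * u n

theorem aperyOp_den_zero (n : ℕ) :
    aperyOp (fun i => aperyBinom i 0 ^ 2) n = aperyDenCert (n + 1) 0 := by
  simp only [aperyOp, aperyDenCert, aperyBinom_zero]
  push_cast
  ring

theorem aperyOp_num_zero (n : ℕ) :
    aperyOp (fun i => aperyBinom i 0 ^ 2 * aperyApprox i 0) n = aperyNumCert (n + 1) 0 := by
  simp only [aperyOp, aperyNumCert, aperyDenCert, aperyBinom_zero, aperyApprox_zero,
    cubeHarmonic_succ]
  push_cast
  field_simp
  ring

theorem aperyOp_den_succ {n k : ℕ} (h : k ≤ n) :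
    aperyOp (fun i => aperyBinom i (k + 1) ^ 2) n
      = aperyDenCert (n + 1) (k + 1) - aperyDenCert (n + 1) k := by
  obtain ⟨j, rfl⟩ := Nat.exists_eq_add_of_le h
  obtain ⟨f1, f2, f3⟩ := aperyBinom_neighbours k j
  simp only [aperyOp, aperyDenCert]
  rw [f1, f2, f3]
  generalize aperyBinom (k + j + 1) (k + 1) = D
  push_cast
  field_simp
  ring

theorem aperyOp_num_succ {n k : ℕ} (h : k ≤ n) :
    aperyOp (fun i => aperyBinom i (k + 1) ^ 2 * aperyApprox i (k + 1)) n
      = aperyNumCert (n + 1) (k + 1) - aperyNumCert (n + 1) k := by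
  have hden := aperyOp_den_succ h
  have hup := aperyApprox_succ_left (show k + 1 ≤ n + 1 by omega)
  have hlow : aperyBinom n (k + 1) ^ 2 * aperyApprox n (k + 1)
      = aperyBinom n (k + 1) ^ 2 * aperyApprox (n + 1) (k + 1)
        + (-1) ^ k * aperyBinom n (k + 1) / (((n : ℚ) + 1) ^ 2 * (n + 2 + k)) := by
    rcases Nat.lt_or_ge n (k + 1) with hk | hk
    · rw [aperyBinom_eq_zero hk]; ring
    · have hD := (aperyBinom_pos hk).ne'
      rw [aperyApprox_succ_left hk, pow_succ (-1 : ℚ) k]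
      push_cast
      field_simp
      ring
  have hright : aperyApprox (n + 1) k = aperyApprox (n + 1) (k + 1) -
      (-1) ^ k / (2 * ((k : ℚ) + 1) ^ 3 * aperyBinom (n + 1) (k + 1)) := by
    rw [aperyApprox_succ_right]; ring
  have hD := (aperyBinom_pos (show k + 1 ≤ n + 1 by omega)).ne'
  simp only [aperyOp, aperyNumCert] at hden ⊢
  rw [hlow, hup, hright]
  generalize aperyApprox (n + 1) (k + 1) = c
  obtain ⟨j, rfl⟩ := Nat.exists_eq_add_of_le h
  obtain ⟨f1, f2, f3⟩ := aperyBinom_neighbours k j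
  suffices key : ((k + j : ℕ) + 2 : ℚ) ^ 3 * (aperyBinom (k + j + 2) (k + 1) ^ 2 *
        ((-1) ^ (k + 1) / ((((k + j + 1 : ℕ) : ℚ) + 1) ^ 2 * aperyBinom (k + j + 1) (k + 1) *
          (((k + j + 1 : ℕ) : ℚ) + 1 + ((k + 1 : ℕ) : ℚ)))))
      + ((k + j : ℕ) + 1 : ℚ) ^ 3 * ((-1) ^ k * aperyBinom (k + j) (k + 1) /
          ((((k + j : ℕ) : ℚ) + 1) ^ 2 * (((k + j : ℕ) : ℚ) + 2 + k)))
      = - (5 * (2 * ((k + j + 1 : ℕ) : ℚ) + 1) * (-1) ^ (k + 1) * ((k + 1 : ℕ) : ℚ) /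
          (((k + j + 1 : ℕ) : ℚ) * (((k + j + 1 : ℕ) : ℚ) + 1)) * aperyBinom (k + j + 1) (k + 1))
        + aperyDenCert (k + j + 1) k *
          ((-1) ^ k / (2 * ((k : ℚ) + 1) ^ 3 * aperyBinom (k + j + 1) (k + 1)))
        + 5 * (2 * ((k + j + 1 : ℕ) : ℚ) + 1) * (-1) ^ k * (k : ℚ) /
          (((k + j + 1 : ℕ) : ℚ) * (((k + j + 1 : ℕ) : ℚ) + 1)) * aperyBinom (k + j + 1) k by
    linear_combination c * hden + key
  rw [aperyDenCert, f1, f2, f3, pow_succ (-1 : ℚ) k]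
  generalize aperyBinom (k + j + 1) (k + 1) = D at *
  generalize ((-1 : ℚ)) ^ k = s
  push_cast
  field_simp
  ring

theorem aperyBinom_diag_succ (n : ℕ) :
    aperyBinom (n + 1) (n + 1) * (n + 1) = 2 * (2 * n + 1) * aperyBinom n n := by
  have e1 := aperyBinom_succ_left n n
  have e2 := aperyBinom_succ_right (n + 1) n
  have p : (n : ℚ) + 1 ≠ 0 := by positivity
  push_cast at e1 e2
  apply mul_right_cancel₀ p
  linear_combination e2 + 2 * (n + 1) * e1

theorem aperyOp_den_top (n : ℕ) :
    aperyOp (fun i => aperyBinom i (n + 2) ^ 2) n = -aperyDenCert (n + 1) (n + 1) := by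
  have e := aperyBinom_diag_succ (n + 1)
  have p : (n : ℚ) + 1 + 1 ≠ 0 := by positivity
  push_cast at e
  have f : aperyBinom (n + 2) (n + 2)
      = 2 * (2 * (n + 1) + 1) * aperyBinom (n + 1) (n + 1) / (n + 1 + 1) := by
    rw [eq_div_iff p]; linear_combination e
  simp only [aperyOp, aperyDenCert]
  rw [f, aperyBinom_eq_zero (show n < n + 2 by omega),
    aperyBinom_eq_zero (show n + 1 < n + 2 by omega)]
  push_cast
  field_simp
  ring

theorem aperyOp_num_top (n : ℕ) :
    aperyOp (fun i => aperyBinom i (n + 2) ^ 2 * aperyApprox i (n + 2)) n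
      = -aperyNumCert (n + 1) (n + 1) := by
  have e := aperyBinom_diag_succ (n + 1)
  have p : (n : ℚ) + 1 + 1 ≠ 0 := by positivity
  have hD := (aperyBinom_pos (le_refl (n + 1))).ne'
  push_cast at e
  have f : aperyBinom (n + 2) (n + 2)
      = 2 * (2 * (n + 1) + 1) * aperyBinom (n + 1) (n + 1) / (n + 1 + 1) := by
    rw [eq_div_iff p]; linear_combination e
  simp only [aperyOp, aperyNumCert, aperyDenCert]
  rw [aperyBinom_eq_zero (show n < n + 2 by omega),
    aperyBinom_eq_zero (show n + 1 < n + 2 by omega),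
    aperyApprox_succ_right (n + 2) (n + 1), aperyApprox_succ_left (le_refl (n + 1)), f,
    pow_succ (-1 : ℚ) n]
  generalize aperyBinom (n + 1) (n + 1) = D at *
  generalize ((-1 : ℚ)) ^ n = s
  push_cast
  field_simp
  ring

/-- Creative telescoping for Apéry's operator applied to sums supported on `k ≤ i`. -/
theorem aperyOp_sum_eq_zero (F : ℕ → ℕ → ℚ) (G : ℕ → ℚ) (n : ℕ)
    (hF : ∀ i k, i < k → F i k = 0)
    (h0 : aperyOp (fun i => F i 0) n = G 0)
    (hsucc : ∀ k ≤ n, aperyOp (fun i => F i (k + 1)) n = G (k + 1) - G k)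
    (htop : aperyOp (fun i => F i (n + 2)) n = -G (n + 1)) :
    aperyOp (fun i => ∑ k ∈ Finset.range (i + 1), F i k) n = 0 := by
  have h1 : ∑ k ∈ Finset.range (n + 1 + 1), F (n + 1) k
      = ∑ k ∈ Finset.range (n + 3), F (n + 1) k := by
    rw [Finset.sum_range_succ _ (n + 2), hF _ _ (by omega), add_zero]
  have h2 : ∑ k ∈ Finset.range (n + 1), F n k = ∑ k ∈ Finset.range (n + 3), F n k := by
    rw [Finset.sum_range_succ _ (n + 2), Finset.sum_range_succ _ (n + 1), hF n _ (by omega),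
      hF n _ (by omega), add_zero, add_zero]
  have hpart : ∀ m ≤ n + 1,
      ∑ k ∈ Finset.range (m + 1), aperyOp (fun i => F i k) n = G m := by
    intro m hm
    induction m with
    | zero => simpa using h0
    | succ m ih => rw [Finset.sum_range_succ, ih (by omega), hsucc m (by omega)]; ring
  have hall : ∑ k ∈ Finset.range (n + 3), aperyOp (fun i => F i k) n = 0 := by
    rw [Finset.sum_range_succ, hpart (n + 1) le_rfl, htop]; ring
  simp only [aperyOp, Finset.sum_add_distrib, Finset.sum_sub_distrib, ← Finset.mul_sum] at hall
  simp only [aperyOp]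
  rw [h1, h2]
  exact hall

theorem aperyOp_aperyDen (n : ℕ) : aperyOp aperyDen n = 0 :=
  aperyOp_sum_eq_zero (fun i k => aperyBinom i k ^ 2) (aperyDenCert (n + 1)) n
    (fun i k h => by simp [aperyBinom_eq_zero h]) (aperyOp_den_zero n)
    (fun _ h => aperyOp_den_succ h) (aperyOp_den_top n)

theorem aperyOp_aperyNum (n : ℕ) : aperyOp aperyNum n = 0 :=
  aperyOp_sum_eq_zero (fun i k => aperyBinom i k ^ 2 * aperyApprox i k) (aperyNumCert (n + 1)) n
    (fun i k h => by simp [aperyBinom_eq_zero h]) (aperyOp_num_zero n)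
    (fun _ h => aperyOp_num_succ h) (aperyOp_num_top n)

/-- A solution of Apéry's recurrence is determined by its first two values. -/
theorem eq_of_aperyOp_eq_zero {u v : ℕ → ℚ} (h0 : u 0 = v 0) (h1 : u 1 = v 1)
    (hu : ∀ n, aperyOp u n = 0) (hv : ∀ n, aperyOp v n = 0) (n : ℕ) : u n = v n := by
  induction n using Nat.strong_induction_on with
  | _ n ih =>
    match n with
    | 0 => exact h0
    | 1 => exact h1
    | n + 2 =>
      have hun := hu n
      have hvn := hv n
      have p : ((n : ℚ) + 2) ^ 3 ≠ 0 := by positivity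
      simp only [aperyOp] at hun hvn
      rw [ih n (by omega), ih (n + 1) (by omega)] at hun
      apply mul_left_cancel₀ p
      linear_combination hun - hvn

theorem aperyOp_eq_zero_of_recurrence {u : ℕ → ℚ}
    (hu : ∀ n : ℕ, 2 ≤ n →
      (n : ℚ) ^ 3 * u n
        = (34 * (n : ℚ) ^ 3 - 51 * (n : ℚ) ^ 2 + 27 * (n : ℚ) - 5) * u (n - 1)
          - ((n : ℚ) - 1) ^ 3 * u (n - 2)) (n : ℕ) : aperyOp u n = 0 := by
  have h := hu (n + 2) (by omega)
  rw [show n + 2 - 1 = n + 1 by omega, show n + 2 - 2 = n by omega] at h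
  push_cast at h
  rw [aperyOp]
  linear_combination h

theorem aperyDen_pos (n : ℕ) : 0 < aperyDen n :=
  Finset.sum_pos (fun k hk => pow_pos (aperyBinom_pos (by simpa [Nat.lt_succ_iff] using hk)) 2)
    ⟨0, by simp⟩

theorem cubeHarmonic_mono : Monotone cubeHarmonic :=
  monotone_nat_of_le_succ fun n => by
    rw [cubeHarmonic_succ]
    have : (0 : ℚ) ≤ 1 / ((n : ℚ) + 1) ^ 3 := by positivity
    linarith

theorem abs_aperyCorrection_le {n k : ℕ} (h : k ≤ n) :
    |aperyCorrection n k| ≤ cubeHarmonic n / (n + 1) := by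
  refine le_trans ?_ (div_le_div_of_nonneg_right (cubeHarmonic_mono h) (by positivity))
  rw [aperyCorrection, cubeHarmonic, Finset.sum_div]
  refine (Finset.abs_sum_le_sum_abs _ _).trans (Finset.sum_le_sum fun m hm => ?_)
  have hm' : m + 1 ≤ n := by have := Finset.mem_range.mp hm; omega
  have hD := le_aperyBinom (Nat.le_add_left 1 m) hm'
  have hD0 := aperyBinom_pos hm'
  rw [abs_div, abs_pow, abs_neg, abs_one, one_pow, div_div, abs_of_pos (by positivity)]
  refine one_div_le_one_div_of_le (by positivity) ?_
  have p : (0 : ℚ) < ((m : ℚ) + 1) ^ 3 := by positivity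
  nlinarith [mul_le_mul_of_nonneg_left hD p.le, mul_pos p hD0]

theorem abs_aperyNum_div_sub_le (n : ℕ) :
    |aperyNum n / aperyDen n - cubeHarmonic n| ≤ cubeHarmonic n / (n + 1) := by
  have hpos := aperyDen_pos n
  have hsplit : aperyNum n / aperyDen n - cubeHarmonic n
      = (∑ k ∈ Finset.range (n + 1), aperyBinom n k ^ 2 * aperyCorrection n k) / aperyDen n := by
    rw [eq_div_iff hpos.ne', sub_mul, div_mul_cancel₀ _ hpos.ne']
    simp only [aperyNum, aperyDen, aperyApprox, mul_add, Finset.sum_add_distrib, Finset.mul_sum]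
    rw [add_sub_right_comm, ← Finset.sum_sub_distrib]
    simp [mul_comm]
  rw [hsplit, abs_div, abs_of_pos hpos, div_le_iff₀ hpos, aperyDen, Finset.mul_sum]
  refine (Finset.abs_sum_le_sum_abs _ _).trans (Finset.sum_le_sum fun k hk => ?_)
  rw [abs_mul, abs_of_nonneg (sq_nonneg _), mul_comm]
  exact mul_le_mul_of_nonneg_right
    (abs_aperyCorrection_le (by have := Finset.mem_range.mp hk; omega)) (sq_nonneg _)

theorem summable_one_div_succ_cube : Summable fun k : ℕ => 1 / ((k : ℝ) + 1) ^ 3 := by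
  have h := (summable_nat_add_iff 1).mpr
    (Real.summable_one_div_nat_pow.mpr (show 1 < 3 by norm_num))
  simpa using h

theorem tsum_one_div_succ_cube_pos : 0 < ∑' k : ℕ, 1 / ((k : ℝ) + 1) ^ 3 :=
  summable_one_div_succ_cube.tsum_pos (fun k => by positivity) 0 (by norm_num)

theorem tendsto_cubeHarmonic :
    Tendsto (fun n => (cubeHarmonic n : ℝ)) atTop (nhds (∑' k : ℕ, 1 / ((k : ℝ) + 1) ^ 3)) := by
  refine summable_one_div_succ_cube.hasSum.tendsto_sum_nat.congr fun n => ?_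
  simp [cubeHarmonic]

theorem tendsto_aperyNum_div_aperyDen :
    Tendsto (fun n => (aperyNum n : ℝ) / (aperyDen n : ℝ)) atTop
      (nhds (∑' k : ℕ, 1 / ((k : ℝ) + 1) ^ 3)) := by
  have hbound : Tendsto (fun n : ℕ => (cubeHarmonic n : ℝ) / ((n : ℝ) + 1)) atTop (nhds 0) := by
    simpa [div_eq_mul_inv] using
      tendsto_cubeHarmonic.mul tendsto_one_div_add_atTop_nhds_zero_nat
  have hdiff : Tendsto (fun n => (aperyNum n : ℝ) / (aperyDen n : ℝ) - (cubeHarmonic n : ℝ))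
      atTop (nhds 0) := by
    refine squeeze_zero_norm (fun n => ?_) hbound
    rw [Real.norm_eq_abs]
    exact_mod_cast abs_aperyNum_div_sub_le n
  simpa using hdiff.add tendsto_cubeHarmonic

/-- For the two solutions `(aₙ)` (with `a₀ = 1`, `a₁ = 5`) and
`(bₙ)` (with `b₀ = 0`, `b₁ = 1`) of Apéry's recursion
`n³·uₙ = (34n³ − 51n² + 27n − 5)·u_{n−1} − (n−1)³·u_{n−2}` (attached to the
Picard–Fuchs operator of `V₁₂`), all `aₙ` are nonzero and `bₙ/aₙ` converges to
`c·ζ(3)` for some nonzero rational `c`. -/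
theorem apery_constant_V12 (a b : ℕ → ℚ)
    (ha0 : a 0 = 1) (ha1 : a 1 = 5) (hb0 : b 0 = 0) (hb1 : b 1 = 1)
    (hreca : ∀ n : ℕ, 2 ≤ n →
      (n : ℚ) ^ 3 * a n
        = (34 * (n : ℚ) ^ 3 - 51 * (n : ℚ) ^ 2 + 27 * (n : ℚ) - 5) * a (n - 1)
          - ((n : ℚ) - 1) ^ 3 * a (n - 2))
    (hrecb : ∀ n : ℕ, 2 ≤ n →
      (n : ℚ) ^ 3 * b n
        = (34 * (n : ℚ) ^ 3 - 51 * (n : ℚ) ^ 2 + 27 * (n : ℚ) - 5) * b (n - 1)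
          - ((n : ℚ) - 1) ^ 3 * b (n - 2)) :
    (∀ n : ℕ, a n ≠ 0) ∧
      ∃ c : ℚ, c ≠ 0 ∧
        Tendsto (fun n : ℕ => (b n : ℝ) / (a n : ℝ)) atTop
          (nhds ((c : ℝ) * ∑' k : ℕ, 1 / ((k : ℝ) + 1) ^ 3)) := by
  have ha : ∀ n, a n = aperyDen n :=
    eq_of_aperyOp_eq_zero
      (by rw [ha0]; simp [aperyDen])
      (by rw [ha1]; norm_num [aperyDen, Finset.sum_range_succ, aperyBinom])
      (aperyOp_eq_zero_of_recurrence hreca) aperyOp_aperyDen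
  have hb : ∀ n, 6 * b n = aperyNum n :=
    eq_of_aperyOp_eq_zero (u := fun n => 6 * b n)
      (by simp [hb0, aperyNum, aperyApprox, aperyCorrection, cubeHarmonic])
      (by norm_num [hb1, aperyNum, Finset.sum_range_succ, aperyBinom, aperyApprox,
            aperyCorrection, cubeHarmonic])
      (fun n => by
        have h := aperyOp_eq_zero_of_recurrence hrecb n
        simp only [aperyOp] at h ⊢
        linear_combination 6 * h)
      aperyOp_aperyNum
  refine ⟨fun n => by rw [ha]; exact (aperyDen_pos n).ne', 1 / 6, by norm_num, ?_⟩
  have h := tendsto_aperyNum_div_aperyDen.const_mul ((1 / 6 : ℚ) : ℝ)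
  refine h.congr fun n => ?_
  rw [ha, ← hb]
  push_cast
  ring
end
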